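/- There is no bounded linear operator Ω: U→V between separable Banach spaces that is both isometrically universal and homogeneous. -/

import Mathlib

/-- `Ω : U → V` is isometrically universal: every bounded linear operator between separable
Banach spaces whose norm does not exceed `‖Ω‖` embeds isometrically into `Ω`. -/
def IsometricallyUniversal {U V : Type*} [NormedAddCommGroup U] [NormedSpace ℝ U]
    [NormedAddCommGroup V] [NormedSpace ℝ V] (Ω : U →L[ℝ] V) : Prop :=
  ∀ (X Y : Type) [NormedAddCommGroup X] [NormedSpace ℝ X] [CompleteSpace X]
    [TopologicalSpace.SeparableSpace X]
    [NormedAddCommGroup Y] [NormedSpace ℝ Y] [CompleteSpace Y]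
    [TopologicalSpace.SeparableSpace Y]
    (T : X →L[ℝ] Y), ‖T‖ ≤ ‖Ω‖ →
    ∃ (i : X →ₗᵢ[ℝ] U) (j : Y →ₗᵢ[ℝ] V), ∀ x : X, Ω (i x) = j (T x)

/-- `Ω : U → V` is homogeneous: every commuting pair of isometries between
finite-dimensional subspaces extends to a commuting pair of surjective isometries
of `U` and `V`. -/
def IsHomogeneousOperator {U V : Type*} [NormedAddCommGroup U] [NormedSpace ℝ U]
    [NormedAddCommGroup V] [NormedSpace ℝ V] (Ω : U →L[ℝ] V) : Prop :=
  ∀ (X₀ X₁ : Submodule ℝ U) (Y₀ Y₁ : Submodule ℝ V),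
    FiniteDimensional ℝ X₀ → FiniteDimensional ℝ X₁ →
    FiniteDimensional ℝ Y₀ → FiniteDimensional ℝ Y₁ →
    ∀ (hX₀ : ∀ x ∈ X₀, Ω x ∈ Y₀) (_ : ∀ x ∈ X₁, Ω x ∈ Y₁)
      (i : X₀ →ₗᵢ[ℝ] X₁) (j : Y₀ →ₗᵢ[ℝ] Y₁),
      (∀ x : X₀, Ω ((i x : U)) = (j ⟨Ω x, hX₀ x x.2⟩ : V)) →
      ∃ (I : U →ₗᵢ[ℝ] U) (J : V →ₗᵢ[ℝ] V),
        Function.Surjective I ∧ Function.Surjective J ∧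
        (∀ x : U, Ω (I x) = J (Ω x)) ∧
        (∀ x : X₀, I (x : U) = ((i x : X₁) : U)) ∧
        (∀ y : Y₀, J (y : V) = ((j y : Y₁) : V))

/-- The sup over slopes argument: a dense-direction non-smoothness everywhere is impossible. -/
theorem aux_no_kinks {V : Type} [NormedAddCommGroup V] [NormedSpace ℝ V] [CompleteSpace V]
    [TopologicalSpace.SeparableSpace V]
    (H : ∀ v : V, ∃ w : V, ∀ t : ℝ, ‖v + t • w‖ = ‖v‖ + |t|) : False := by
  let A : ℕ → Set V := fun n => {v | ∀ t : ℝ, 0 ≤ t →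
    t ≤ ‖v + t • TopologicalSpace.denseSeq V n‖ + ‖v - t • TopologicalSpace.denseSeq V n‖
      - 2 * ‖v‖}
  have hc : ∀ n, IsClosed (A n) := by
    intro n
    simp only [A, Set.ofPred_forall]
    refine isClosed_iInter fun t => isClosed_iInter fun _ => ?_
    exact isClosed_le (by fun_prop) (by fun_prop)
  have hU : ⋃ n, A n = Set.univ := by
    refine Set.eq_univ_of_forall fun v => ?_
    obtain ⟨w, hw⟩ := H v
    obtain ⟨n, hn⟩ := (TopologicalSpace.denseRange_denseSeq V).exists_dist_lt w
      (show (0:ℝ) < 1 / 4 by norm_num)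
    refine Set.mem_iUnion.2 ⟨n, fun t ht => ?_⟩
    set d := TopologicalSpace.denseSeq V n
    rw [dist_eq_norm] at hn
    have h1 := hw t
    have h2 := hw (-t)
    rw [abs_neg, abs_of_nonneg ht] at h2
    rw [abs_of_nonneg ht] at h1
    have h3 : ‖t • (w - d)‖ ≤ t * (1 / 4) := by
      rw [norm_smul, Real.norm_eq_abs, abs_of_nonneg ht]
      exact mul_le_mul_of_nonneg_left hn.le ht
    have h4 : ‖v + t • w‖ ≤ ‖v + t • d‖ + ‖t • (w - d)‖ := by
      have : v + t • w = (v + t • d) + t • (w - d) := by module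
      rw [this]; exact norm_add_le _ _
    have h5 : ‖v + (-t) • w‖ ≤ ‖v - t • d‖ + ‖t • (w - d)‖ := by
      have : v + (-t) • w = (v - t • d) - t • (w - d) := by module
      rw [this]; exact norm_sub_le _ _
    linarith
  obtain ⟨n, v, hv⟩ := nonempty_interior_of_iUnion_of_closed hc hU
  obtain ⟨δ, hδ, hball⟩ := Metric.mem_nhds_iff.1 (mem_interior_iff_mem_nhds.1 hv)
  set d := TopologicalSpace.denseSeq V n with hd
  obtain ⟨N, hN⟩ := exists_nat_gt (2 * ‖d‖)
  have hN0 : (0:ℝ) < N := lt_of_le_of_lt (by positivity) hN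
  -- step size
  let h : ℝ := δ / (N * (‖d‖ + 1))
  have hh : 0 < h := by positivity
  have hhN : N * h * (‖d‖ + 1) = δ := by simp only [h]; field_simp
  let a : ℕ → ℝ := fun k => ‖v + ((k:ℝ) * h) • d‖
  have step : ∀ k : ℕ, k ≤ N → -(h * ‖d‖) + k * h ≤ a (k + 1) - a k := by
    intro k
    induction k with
    | zero =>
      intro _
      have : ‖v‖ ≤ ‖v + h • d‖ + ‖h • d‖ := by
        have := norm_sub_le (v + h • d) (h • d)
        rwa [add_sub_cancel_right] at this
      rw [norm_smul, Real.norm_eq_abs, abs_of_pos hh] at this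
      simp only [a]
      norm_num
      linarith
    | succ k ih =>
      intro hk
      have ih := ih (by omega)
      have hkN : ((k + 1 : ℕ) : ℝ) ≤ N := by exact_mod_cast hk
      have hmem : v + (((k + 1 : ℕ):ℝ) * h) • d ∈ Metric.ball v δ := by
        rw [Metric.mem_ball, dist_eq_norm, add_sub_cancel_left, norm_smul, Real.norm_eq_abs,
          abs_of_nonneg (by positivity)]
        have e1 : ((k + 1 : ℕ):ℝ) * h * ‖d‖ ≤ N * h * ‖d‖ := by gcongr
        have e2 : 0 < N * h := by positivity
        nlinarith
      have := hball hmem h hh.le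
      rw [← hd] at this
      have e1 : v + (((k + 1 : ℕ):ℝ) * h) • d + h • d = v + (((k + 1 + 1 : ℕ):ℝ) * h) • d := by
        push_cast; module
      have e2 : v + (((k + 1 : ℕ):ℝ) * h) • d - h • d = v + ((k : ℝ) * h) • d := by
        push_cast; module
      rw [e1, e2] at this
      simp only [a] at ih ⊢
      push_cast at this ih ⊢
      linarith
  have h1 := step N le_rfl
  have h2 : a (N + 1) ≤ a N + h * ‖d‖ := by
    have := norm_add_le (v + ((N:ℝ) * h) • d) (h • d)
    rw [norm_smul, Real.norm_eq_abs, abs_of_pos hh] at this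
    have e : v + ((N:ℝ) * h) • d + h • d = v + (((N + 1 : ℕ):ℝ) * h) • d := by
      push_cast; module
    rw [e] at this
    exact this
  nlinarith

/-- No bounded linear operator between separable Banach spaces is both isometrically
universal and homogeneous. -/
theorem no_isometrically_universal_homogeneous_operator
    {U V : Type} [NormedAddCommGroup U] [NormedSpace ℝ U] [CompleteSpace U]
    [TopologicalSpace.SeparableSpace U]
    [NormedAddCommGroup V] [NormedSpace ℝ V] [CompleteSpace V]
    [TopologicalSpace.SeparableSpace V]
    (Ω : U →L[ℝ] V) :
    ¬ (IsometricallyUniversal Ω ∧ IsHomogeneousOperator Ω) := by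
  rintro ⟨hu, hh⟩
  obtain ⟨-, e, -⟩ := hu PUnit (WithLp 1 (ℝ × ℝ)) 0 (by simp)
  set v₀ : V := e (WithLp.toLp 1 (1, 0)) with hv₀
  set w₀ : V := e (WithLp.toLp 1 (0, 1)) with hw₀
  have key : ∀ r t : ℝ, ‖r • v₀ + t • w₀‖ = |r| + |t| := by
    intro r t
    rw [hv₀, hw₀, ← map_smul, ← map_smul, ← map_add, e.norm_map, WithLp.prod_norm_eq_of_L1]
    simp
  have hv1 : ‖v₀‖ = 1 := by simpa using key 1 0
  refine aux_no_kinks (V := V) fun v => ?_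
  by_cases hv : v = 0
  · refine ⟨w₀, fun t => ?_⟩
    simpa [hv] using key 0 t
  have hn : ‖v‖ ≠ 0 := norm_ne_zero_iff.2 hv
  have hu1 : ‖‖v‖⁻¹ • v‖ = 1 := by
    rw [norm_smul, norm_inv, norm_norm, inv_mul_cancel₀ hn]
  let j : (Submodule.span ℝ {v₀}) →ₗᵢ[ℝ] (Submodule.span ℝ {‖v‖⁻¹ • v}) :=
    (LinearIsometryEquiv.toSpanUnitSingleton (𝕜 := ℝ) _ hu1).toLinearIsometry.comp
      (LinearIsometryEquiv.toSpanUnitSingleton (𝕜 := ℝ) _ hv1).symm.toLinearIsometry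
  obtain ⟨-, J, -, -, -, -, hJ⟩ := hh ⊥ ⊥ (Submodule.span ℝ {v₀}) (Submodule.span ℝ {‖v‖⁻¹ • v})
    inferInstance inferInstance inferInstance inferInstance
    (by intro x hx; rw [(Submodule.mem_bot ℝ).1 hx, map_zero]; exact zero_mem _)
    (by intro x hx; rw [(Submodule.mem_bot ℝ).1 hx, map_zero]; exact zero_mem _)
    LinearIsometry.id j (by
      rintro ⟨x, hx⟩
      obtain rfl := (Submodule.mem_bot ℝ).1 hx
      have hz : ∀ z : Submodule.span ℝ {v₀}, (z : V) = 0 → (0 : V) = j z := by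
        intro z hz
        have hz0 : z = 0 := Subtype.ext hz
        rw [hz0, map_zero]; rfl
      exact (map_zero Ω).trans (hz _ (map_zero Ω)))
  have hJv : J v₀ = ‖v‖⁻¹ • v := by
    have := hJ ⟨v₀, Submodule.mem_span_singleton_self v₀⟩
    have e2 : (LinearIsometryEquiv.toSpanUnitSingleton (𝕜 := ℝ) _ hv1).symm
        ⟨v₀, Submodule.mem_span_singleton_self v₀⟩ = 1 := by
      rw [LinearIsometryEquiv.symm_apply_eq]
      ext
      simp
    have e3 : j ⟨v₀, Submodule.mem_span_singleton_self v₀⟩ =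
        LinearIsometryEquiv.toSpanUnitSingleton (𝕜 := ℝ) _ hu1 1 := 
      congrArg (fun r => LinearIsometryEquiv.toSpanUnitSingleton (𝕜 := ℝ) _ hu1 r) e2
    rw [e3] at this
    simpa using this
  refine ⟨J w₀, fun t => ?_⟩
  have : v + t • J w₀ = J (‖v‖ • v₀ + t • w₀) := by
    rw [map_add, map_smul, map_smul, hJv, smul_smul, mul_inv_cancel₀ hn, one_smul]
  rw [this, J.norm_map, key, abs_norm]
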